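/- Let H be a weak Hopf algebra over k whose antipode S is bijective with inverse S̄, and let A be a right H-comodule algebra. Define k-linear self-maps of A⊗H by η(a⊗h) = a₍₀₎ ⊗ a₍₁₎S(h), η̄(a⊗h) = a₍₀₎ ⊗ S̄(h)a₍₁₎, p(a⊗h) = a1₍₀₎ ⊗ h1₍₁₎ and p̄(a⊗h) = 1₍₀₎a ⊗ 1₍₁₎h. Then η∘p = η, η̄∘p̄ = η̄, η̄∘η = p and η∘η̄ = p̄. Consequently η restricts to a bijection from (A⊗H)ρ(1) onto ρ(1)(A⊗H) whose inverse is the restriction of η̄. -/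

import Mathlib

noncomputable section

open TensorProduct LinearMap

/-- A weak bialgebra over a field `k`: a finite-dimensional `k`-algebra with a `k`-coalgebra
structure whose comultiplication is multiplicative, with the weakened unit and counit axioms. -/
structure WeakBialgebra (k : Type*) [Field k] (H : Type*) [Ring H] [Algebra k H]
    [FiniteDimensional k H] where
  comul : H →ₗ[k] H ⊗[k] H
  counit : H →ₗ[k] k
  coassoc : ∀ x : H,
    (TensorProduct.assoc k H H H) ((rTensor H comul) (comul x)) = (lTensor H comul) (comul x)
  rTensor_counit_comul : ∀ x : H, (TensorProduct.lid k H) ((rTensor H counit) (comul x)) = x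
  lTensor_counit_comul : ∀ x : H, (TensorProduct.rid k H) ((lTensor H counit) (comul x)) = x
  comul_mul : ∀ a b : H, comul (a * b) = comul a * comul b
  -- `1₍₁₎ ⊗ 1₍₂₎ ⊗ 1₍₃₎ = (Δ(1) ⊗ 1)(1 ⊗ Δ(1)) = (1 ⊗ Δ(1))(Δ(1) ⊗ 1)`
  weak_one₁ : (lTensor H comul) (comul 1)
    = (TensorProduct.assoc k H H H) ((comul 1) ⊗ₜ[k] (1 : H)) * ((1 : H) ⊗ₜ[k] (comul 1))
  weak_one₂ : (lTensor H comul) (comul 1)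
    = ((1 : H) ⊗ₜ[k] (comul 1)) * (TensorProduct.assoc k H H H) ((comul 1) ⊗ₜ[k] (1 : H))
  -- `ε(abc) = ε(ab₍₁₎)ε(b₍₂₎c) = ε(ab₍₂₎)ε(b₍₁₎c)`
  weak_counit₁ : ∀ a b c : H, counit (a * b * c)
    = (LinearMap.mul' k k)
        ((TensorProduct.map (counit ∘ₗ mulLeft k a) (counit ∘ₗ mulRight k c)) (comul b))
  weak_counit₂ : ∀ a b c : H, counit (a * b * c)
    = (LinearMap.mul' k k)
        ((TensorProduct.map (counit ∘ₗ mulRight k c) (counit ∘ₗ mulLeft k a)) (comul b))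

namespace WeakBialgebra

variable {k : Type*} [Field k] {H : Type*} [Ring H] [Algebra k H] [FiniteDimensional k H]
variable (wb : WeakBialgebra k H)

/-- `ε ⊗ id : H ⊗ H → H`. -/
def εid : H ⊗[k] H →ₗ[k] H := (TensorProduct.lid k H).toLinearMap ∘ₗ rTensor H wb.counit

/-- `id ⊗ ε : H ⊗ H → H`. -/
def idε : H ⊗[k] H →ₗ[k] H := (TensorProduct.rid k H).toLinearMap ∘ₗ lTensor H wb.counit

/-- `Π^L(x) = ε(1₍₁₎x) 1₍₂₎`. -/
def projL : H →ₗ[k] H :=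
  wb.εid ∘ₗ mulLeft k (wb.comul 1) ∘ₗ (TensorProduct.mk k H H).flip 1

/-- `Π^R(x) = 1₍₁₎ ε(x1₍₂₎)`. -/
def projR : H →ₗ[k] H :=
  wb.idε ∘ₗ mulRight k (wb.comul 1) ∘ₗ TensorProduct.mk k H H 1

/-- `Π̄^L(x) = 1₍₁₎ ε(1₍₂₎x)`. -/
def projBarL : H →ₗ[k] H :=
  wb.idε ∘ₗ mulLeft k (wb.comul 1) ∘ₗ TensorProduct.mk k H H 1

/-- `Π̄^R(x) = ε(x1₍₁₎) 1₍₂₎`. -/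
def projBarR : H →ₗ[k] H :=
  wb.εid ∘ₗ mulRight k (wb.comul 1) ∘ₗ (TensorProduct.mk k H H).flip 1

/-- The antipode axioms for a weak Hopf algebra: `S(x₍₁₎)x₍₂₎ = Π^R(x)`,
`x₍₁₎S(x₍₂₎) = Π^L(x)` and `S(x₍₁₎)x₍₂₎S(x₍₃₎) = S(x)`. -/
structure IsAntipode (S : H →ₗ[k] H) : Prop where
  antipode_left : ∀ x : H, LinearMap.mul' k H ((rTensor H S) (wb.comul x)) = wb.projR x
  antipode_right : ∀ x : H, LinearMap.mul' k H ((lTensor H S) (wb.comul x)) = wb.projL x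
  antipode_mid : ∀ x : H,
    LinearMap.mul' k H
      ((TensorProduct.map (LinearMap.mul' k H ∘ₗ rTensor H S) S)
        ((rTensor H wb.comul) (wb.comul x))) = S x

end WeakBialgebra

/-- A right `H`-comodule algebra over a weak bialgebra `H`. -/
structure ComodAlg {k : Type*} [Field k] {H : Type*} [Ring H] [Algebra k H]
    [FiniteDimensional k H] (wb : WeakBialgebra k H)
    (A : Type*) [Ring A] [Algebra k A] where
  ρ : A →ₗ[k] A ⊗[k] H
  coassoc : ∀ a : A,
    (TensorProduct.assoc k A H H) ((rTensor H ρ) (ρ a)) = (lTensor A wb.comul) (ρ a)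
  counital : ∀ a : A, (TensorProduct.rid k A) ((lTensor A wb.counit) (ρ a)) = a
  mul : ∀ a b : A, ρ (a * b) = ρ a * ρ b
  piL : ∀ a : A, (lTensor A wb.projL) (ρ a) = ρ 1 * (a ⊗ₜ[k] (1 : H))
  pibarR : ∀ a : A, (lTensor A wb.projBarR) (ρ a) = (a ⊗ₜ[k] (1 : H)) * ρ 1

namespace ComodAlg

variable {k : Type*} [Field k] {H : Type*} [Ring H] [Algebra k H] [FiniteDimensional k H]
variable {wb : WeakBialgebra k H} {A : Type*} [Ring A] [Algebra k A]

/-- The coinvariant subalgebra `B = {b ∈ A : ρ(b) = 1₍₀₎b ⊗ 1₍₁₎}`. -/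
def coinv (ca : ComodAlg wb A) : Set A := {b | ca.ρ b = ca.ρ 1 * (b ⊗ₜ[k] (1 : H))}

/-- The `B`-balancing relations in `A ⊗_k A`, realizing `A ⊗_B A`. -/
def rel (ca : ComodAlg wb A) : Submodule k (A ⊗[k] A) :=
  Submodule.span k
    {z | ∃ a a' b : A, b ∈ ca.coinv ∧ z = (a * b) ⊗ₜ[k] a' - a ⊗ₜ[k] (b * a')}

/-- `A ⊗_B A`. -/
abbrev QA (ca : ComodAlg wb A) := (A ⊗[k] A) ⧸ ca.rel

/-- The canonical quotient map `A ⊗_k A → A ⊗_B A`. -/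
def mkA (ca : ComodAlg wb A) : A ⊗[k] A →ₗ[k] ca.QA := ca.rel.mkQ

end ComodAlg


namespace WeakBialgebra

variable {k : Type*} [Field k] {H : Type*} [Ring H] [Algebra k H] [FiniteDimensional k H]

/-- The coalgebra structure underlying a weak bialgebra. -/
abbrev toCoalgebra (wb : WeakBialgebra k H) : Coalgebra k H where
  comul := wb.comul
  counit := wb.counit
  coassoc := LinearMap.ext wb.coassoc
  rTensor_counit_comp_comul := LinearMap.ext fun x =>
    (TensorProduct.lid k H).injective <| by simpa using wb.rTensor_counit_comul x
  lTensor_counit_comp_comul := LinearMap.ext fun x =>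
    (TensorProduct.rid k H).injective <| by simpa using wb.lTensor_counit_comul x

variable (wb : WeakBialgebra k H)

theorem projL_eq (x : H) : wb.projL x = wb.εid (wb.comul 1 * (x ⊗ₜ 1)) := rfl

theorem projR_eq (x : H) : wb.projR x = wb.idε ((1 ⊗ₜ x) * wb.comul 1) := rfl

theorem projBarR_eq (x : H) : wb.projBarR x = wb.εid ((x ⊗ₜ 1) * wb.comul 1) := rfl

@[simp]
theorem εid_tmul (x y : H) : wb.εid (x ⊗ₜ y) = wb.counit x • y := by simp [εid]

@[simp]
theorem idε_tmul (x y : H) : wb.idε (x ⊗ₜ y) = wb.counit y • x := by simp [idε]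

theorem comul_one_mul (x : H) : wb.comul 1 * wb.comul x = wb.comul x := by
  rw [← wb.comul_mul, one_mul]

theorem comul_mul_one (x : H) : wb.comul x * wb.comul 1 = wb.comul x := by
  rw [← wb.comul_mul, mul_one]

omit [FiniteDimensional k H] in
theorem assoc_mul (u v : (H ⊗[k] H) ⊗[k] H) :
    TensorProduct.assoc k H H H (u * v)
      = TensorProduct.assoc k H H H u * TensorProduct.assoc k H H H v :=
  map_mul (Algebra.TensorProduct.assoc k k k H H H) u v

/-- `(1 ⊗ Δ(1))(Δ(b) ⊗ 1) = 1₍₁₎b₍₁₎ ⊗ 1₍₂₎b₍₂₎ ⊗ 1₍₃₎`. -/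
theorem one_tmul_comul_one_mul (b : H) :
    ((1 : H) ⊗ₜ[k] wb.comul 1) * TensorProduct.assoc k H H H (wb.comul b ⊗ₜ 1)
      = TensorProduct.assoc k H H H (rTensor H wb.comul (wb.comul 1 * (b ⊗ₜ 1))) := by
  have h (u : H ⊗[k] H) : rTensor H wb.comul (u * (b ⊗ₜ 1))
      = rTensor H wb.comul u * (wb.comul b ⊗ₜ 1) := by
    induction u with
    | zero => simp
    | tmul x y => simp [wb.comul_mul]
    | add u v hu hv => simp only [add_mul, map_add, hu, hv]
  rw [h, assoc_mul, wb.coassoc, wb.weak_one₂, mul_assoc, ← assoc_mul,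
    Algebra.TensorProduct.tmul_mul_tmul, comul_one_mul, one_mul]

/-- `(1 ⊗ Δ(a))(Δ(1) ⊗ 1) = 1₍₁₎ ⊗ a₍₁₎1₍₂₎ ⊗ a₍₂₎1₍₃₎`. -/
theorem one_tmul_comul_mul (a : H) :
    ((1 : H) ⊗ₜ[k] wb.comul a) * TensorProduct.assoc k H H H (wb.comul 1 ⊗ₜ 1)
      = lTensor H wb.comul ((1 ⊗ₜ a) * wb.comul 1) := by
  have h (u : H ⊗[k] H) : lTensor H wb.comul ((1 ⊗ₜ a) * u)
      = (1 ⊗ₜ wb.comul a) * lTensor H wb.comul u := by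
    induction u with
    | zero => simp
    | tmul x y => simp [wb.comul_mul]
    | add u v hu hv => simp only [mul_add, map_add, hu, hv]
  rw [h, wb.weak_one₂, ← mul_assoc, Algebra.TensorProduct.tmul_mul_tmul, comul_mul_one, one_mul]

theorem projR_mul_projL (a b : H) : wb.projR a * wb.projL b = wb.projL b * wb.projR a := by
  have h := wb.weak_one₁.symm.trans wb.weak_one₂
  let F : H ⊗[k] (H ⊗[k] H) →ₗ[k] H := (TensorProduct.lid k H).toLinearMap ∘ₗ
    TensorProduct.map (wb.counit ∘ₗ mulRight k b)
      ((TensorProduct.rid k H).toLinearMap ∘ₗ lTensor H (wb.counit ∘ₗ mulLeft k a))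
  have h₁ (u v : H ⊗[k] H) : F (TensorProduct.assoc k H H H (u ⊗ₜ 1) * (1 ⊗ₜ v))
      = wb.εid (u * (b ⊗ₜ 1)) * wb.idε ((1 ⊗ₜ a) * v) := by
    induction u with
    | zero => simp
    | add u u' hu hu' => simp only [TensorProduct.add_tmul, add_mul, map_add, hu, hu']
    | tmul x y =>
      induction v with
      | zero => simp
      | add v v' hv hv' => simp only [TensorProduct.tmul_add, mul_add, map_add, hv, hv']
      | tmul z w => simp [F, smul_smul]
  have h₂ (u v : H ⊗[k] H) : F ((1 ⊗ₜ v) * TensorProduct.assoc k H H H (u ⊗ₜ 1))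
      = wb.idε ((1 ⊗ₜ a) * v) * wb.εid (u * (b ⊗ₜ 1)) := by
    induction u with
    | zero => simp
    | add u u' hu hu' => simp only [TensorProduct.add_tmul, add_mul, mul_add, map_add, hu, hu']
    | tmul x y =>
      induction v with
      | zero => simp
      | add v v' hv hv' => simp only [TensorProduct.tmul_add, add_mul, mul_add, map_add, hv, hv']
      | tmul z w => simp [F, smul_smul, mul_comm]
  rw [projL_eq, projR_eq, ← h₁, ← h₂, h]

/-- `1₍₁₎ ⊗ Π^L(1₍₂₎) = Δ(1)`. -/
theorem lTensor_projL_comul_one : lTensor H wb.projL (wb.comul 1) = wb.comul 1 := by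
  have h (u v : H ⊗[k] H) :
      lTensor H wb.εid ((1 ⊗ₜ v) * TensorProduct.assoc k H H H (u ⊗ₜ 1))
      = lTensor H (wb.εid ∘ₗ mulLeft k v ∘ₗ (TensorProduct.mk k H H).flip 1) u := by
    induction u with
    | zero => simp
    | add u u' hu hu' => simp only [TensorProduct.add_tmul, mul_add, map_add, hu, hu']
    | tmul x y => simp
  have hcounit (u : H ⊗[k] H) : lTensor H wb.εid (lTensor H wb.comul u) = u := by
    rw [← lTensor_comp_apply]
    convert lTensor_id_apply H H u
    exact LinearMap.ext wb.rTensor_counit_comul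
  calc lTensor H wb.projL (wb.comul 1)
      = lTensor H wb.εid (lTensor H wb.comul (wb.comul 1)) := by rw [wb.weak_one₂, h]; rfl
    _ = wb.comul 1 := hcounit _

/-- `Π^R(1₍₁₎b) ε(a1₍₂₎) = Π^R(ab)`. -/
theorem projR_comul_one_mul (a b : H) :
    wb.idε (TensorProduct.map (wb.projR ∘ₗ mulRight k b) (mulLeft k a) (wb.comul 1))
      = wb.projR (a * b) := by
  have h (v : H ⊗[k] H) :
      wb.idε (TensorProduct.map (wb.idε ∘ₗ mulRight k v ∘ₗ TensorProduct.mk k H H 1 ∘ₗ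
        mulRight k b) (mulLeft k a) (wb.comul 1)) = wb.idε ((1 ⊗ₜ (a * b)) * v) := by
    induction v with
    | zero => simp
    | add v v' hv hv' =>
      rw [mul_add, map_add, ← hv, ← hv', ← map_add]
      congr 1
      induction wb.comul 1 with
      | zero => simp
      | add u u' hu hu' => simp only [map_add, hu, hu']; abel
      | tmul x y => simp [mul_add, TensorProduct.add_tmul]
    | tmul x y =>
      have := wb.weak_counit₂ a 1 (b * y)
      simp only [Algebra.TensorProduct.tmul_mul_tmul, idε_tmul, one_mul]
      rw [mul_one] at this
      rw [mul_assoc, this]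
      induction wb.comul 1 with
      | zero => simp
      | add u u' hu hu' => simp only [map_add, hu, hu', add_smul]
      | tmul z w => simp [smul_smul, mul_comm, mul_assoc]
  exact h _

/-- `ε(1₍₁₎b) Π^L(a1₍₂₎) = Π^L(ab)`. -/
theorem projL_mul_comul_one (a b : H) :
    wb.εid (TensorProduct.map (mulRight k b) (wb.projL ∘ₗ mulLeft k a) (wb.comul 1))
      = wb.projL (a * b) := by
  have h (v : H ⊗[k] H) :
      wb.εid (TensorProduct.map (mulRight k b) (wb.εid ∘ₗ mulLeft k v ∘ₗ
        (TensorProduct.mk k H H).flip 1 ∘ₗ mulLeft k a) (wb.comul 1))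
        = wb.εid (v * ((a * b) ⊗ₜ 1)) := by
    induction v with
    | zero => simp
    | add v v' hv hv' =>
      rw [add_mul, map_add, ← hv, ← hv', ← map_add]
      congr 1
      induction wb.comul 1 with
      | zero => simp
      | add u u' hu hu' => simp only [map_add, hu, hu']; abel
      | tmul x y => simp [add_mul, TensorProduct.tmul_add]
    | tmul x y =>
      have := wb.weak_counit₂ (x * a) 1 b
      simp only [Algebra.TensorProduct.tmul_mul_tmul, εid_tmul, mul_one]
      rw [mul_one] at this
      rw [← mul_assoc, this]
      induction wb.comul 1 with
      | zero => simp
      | add u u' hu hu' => simp only [map_add, hu, hu', add_smul]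
      | tmul z w => simp [smul_smul, mul_comm (wb.counit (z * b))]
  exact h _

/-- `ε(x1₍₁₎) Π^R(1₍₂₎) = Π^R(x)`, that is, `Π^R ∘ Π̄^R = Π^R`. -/
theorem projR_projBarR (x : H) : wb.projR (wb.projBarR x) = wb.projR x := by
  have h (v : H ⊗[k] H) :
      wb.idε ((1 ⊗ₜ wb.projBarR x) * v) = wb.idε ((1 ⊗ₜ x) * v) := by
    induction v with
    | zero => simp
    | add v v' hv hv' => simp only [mul_add, map_add, hv, hv']
    | tmul y z =>
      have := wb.weak_counit₁ x 1 z
      simp only [Algebra.TensorProduct.tmul_mul_tmul, idε_tmul, one_mul]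
      rw [mul_one] at this
      rw [this, projBarR_eq]
      congr 1
      induction wb.comul 1 with
      | zero => simp
      | add u u' hu hu' => simp only [map_add, mul_add, add_mul, hu, hu']
      | tmul z w => simp
  exact h _

namespace IsAntipode

variable {wb} {S : H →ₗ[k] H} (hS : wb.IsAntipode S)
include hS

/-- `S(b₍₁₎)Π^R(a)b₍₂₎ = Π^R(ab)`. -/
theorem antipode_mul_projR_mul (a b : H) :
    LinearMap.mul' k H (TensorProduct.map S (mulLeft k (wb.projR a)) (wb.comul b))
      = wb.projR (a * b) := by
  let F : H ⊗[k] (H ⊗[k] H) →ₗ[k] H := LinearMap.mul' k H ∘ₗ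
    TensorProduct.map S (wb.idε ∘ₗ lTensor H (mulLeft k a))
  have h₁ (u v : H ⊗[k] H) : F ((1 ⊗ₜ v) * TensorProduct.assoc k H H H (u ⊗ₜ 1))
      = LinearMap.mul' k H
        (TensorProduct.map S (mulLeft k (wb.idε ((1 ⊗ₜ a) * v))) u) := by
    induction u with
    | zero => simp
    | add u u' hu hu' => simp only [TensorProduct.add_tmul, mul_add, map_add, hu, hu']
    | tmul x y =>
      induction v with
      | zero => simp
      | add v v' hv hv' =>
        simp only [TensorProduct.tmul_add, add_mul, mul_add, map_add, hv, hv',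
          TensorProduct.map_tmul, mulLeft_apply, mul'_apply]
      | tmul z w => simp [F]
  have h₂ (v : H ⊗[k] H) :
      F (TensorProduct.assoc k H H H (rTensor H wb.comul (v * (b ⊗ₜ 1))))
      = wb.idε (TensorProduct.map (wb.projR ∘ₗ mulRight k b) (mulLeft k a) v) := by
    induction v with
    | zero => simp
    | add v v' hv hv' => simp only [add_mul, map_add, hv, hv']
    | tmul z w =>
      simp only [Algebra.TensorProduct.tmul_mul_tmul, mul_one, rTensor_tmul,
        TensorProduct.map_tmul, idε_tmul, comp_apply, mulRight_apply, mulLeft_apply,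
        ← hS.antipode_left]
      induction wb.comul (z * b) with
      | zero => simp
      | add u u' hu hu' => simp only [TensorProduct.add_tmul, map_add, hu, hu', smul_add]
      | tmul x y => simp [F]
  rw [← projR_comul_one_mul, ← h₂, ← one_tmul_comul_one_mul, h₁, projR_eq]

/-- `a₍₁₎Π^L(b)S(a₍₂₎) = Π^L(ab)`. -/
theorem mul_projL_mul_antipode (a b : H) :
    LinearMap.mul' k H (TensorProduct.map (mulRight k (wb.projL b)) S (wb.comul a))
      = wb.projL (a * b) := by
  let F : H ⊗[k] (H ⊗[k] H) →ₗ[k] H := wb.εid ∘ₗ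
    TensorProduct.map (mulRight k b) (LinearMap.mul' k H ∘ₗ lTensor H S)
  have h₁ (u v : H ⊗[k] H) : F ((1 ⊗ₜ v) * TensorProduct.assoc k H H H (u ⊗ₜ 1))
      = LinearMap.mul' k H
        (TensorProduct.map (mulRight k (wb.εid (u * (b ⊗ₜ 1)))) S v) := by
    induction v with
    | zero => simp
    | add v v' hv hv' => simp only [TensorProduct.tmul_add, add_mul, map_add, hv, hv']
    | tmul x y =>
      induction u with
      | zero => simp
      | add u u' hu hu' =>
        simp only [TensorProduct.add_tmul, add_mul, mul_add, map_add, hu, hu',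
          TensorProduct.map_tmul, mulRight_apply, mul'_apply]
      | tmul z w => simp [F, mul_assoc]
  have h₂ (v : H ⊗[k] H) :
      F (lTensor H wb.comul ((1 ⊗ₜ a) * v))
      = wb.εid (TensorProduct.map (mulRight k b) (wb.projL ∘ₗ mulLeft k a) v) := by
    induction v with
    | zero => simp
    | add v v' hv hv' => simp only [mul_add, map_add, hv, hv']
    | tmul z w => simp [F, hS.antipode_right]
  rw [← projL_mul_comul_one, ← h₂, ← one_tmul_comul_mul, h₁, projL_eq]

/-- `S(x₍₁₎)Π^L(x₍₂₎) = S(x)`. -/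
theorem antipode_mul_projL (x : H) :
    LinearMap.mul' k H (TensorProduct.map S wb.projL (wb.comul x)) = S x := by
  have h (u : H ⊗[k] H) : LinearMap.mul' k H
        (TensorProduct.map (LinearMap.mul' k H ∘ₗ rTensor H S) S (rTensor H wb.comul u))
      = LinearMap.mul' k H (TensorProduct.map S (LinearMap.mul' k H ∘ₗ lTensor H S)
        (TensorProduct.assoc k H H H (rTensor H wb.comul u))) := by
    induction u with
    | zero => simp
    | add u u' hu hu' => simp only [map_add, hu, hu']
    | tmul x y =>
      rw [rTensor_tmul]
      induction wb.comul x with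
      | zero => simp
      | add u u' hu hu' => simp only [TensorProduct.add_tmul, map_add, hu, hu']
      | tmul z w => simp [mul_assoc]
  rw [← hS.antipode_mid, h, wb.coassoc, map_lTensor]
  congr 3
  exact LinearMap.ext fun y => (hS.antipode_right y).symm

/-- `Π^R(x₍₁₎)S(x₍₂₎) = S(x)`. -/
theorem projR_mul_antipode (x : H) :
    LinearMap.mul' k H (TensorProduct.map wb.projR S (wb.comul x)) = S x := by
  rw [← hS.antipode_mid, map_rTensor]
  congr 3
  exact LinearMap.ext fun y => (hS.antipode_left y).symm

theorem antipode_projBarR (x : H) : S (wb.projBarR x) = wb.projR x := by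
  have hf (f : H →ₗ[k] H) : f (wb.projBarR x) =
      TensorProduct.lid k H (TensorProduct.map (wb.counit ∘ₗ mulLeft k x) f (wb.comul 1)) := by
    rw [projBarR_eq]
    induction wb.comul 1 with
    | zero => simp
    | add u u' hu hu' => simp only [mul_add, map_add, hu, hu']
    | tmul y z => simp
  have h₁ : lTensor H (lTensor H wb.projL) (lTensor H wb.comul (wb.comul 1))
      = lTensor H wb.comul (wb.comul 1) := by
    have h (u : (H ⊗[k] H) ⊗[k] H) :
        lTensor H (lTensor H wb.projL) (TensorProduct.assoc k H H H u)
          = TensorProduct.assoc k H H H (lTensor (H ⊗[k] H) wb.projL u)  := by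
      rw [lTensor_tensor]
      simp
    rw [← wb.coassoc, h, ← comp_apply, lTensor_comp_rTensor, ← rTensor_comp_lTensor, comp_apply,
      lTensor_projL_comul_one]
  calc S (wb.projBarR x)
      = (LinearMap.mul' k H ∘ₗ TensorProduct.map S wb.projL ∘ₗ wb.comul) (wb.projBarR x) :=
        (hS.antipode_mul_projL _).symm
    _ = (LinearMap.mul' k H ∘ₗ rTensor H S ∘ₗ wb.comul) (wb.projBarR x) := by
        have h₂ (f : H →ₗ[k] H) : TensorProduct.map (wb.counit ∘ₗ mulLeft k x)
            (LinearMap.mul' k H ∘ₗ TensorProduct.map S f ∘ₗ wb.comul)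
            = TensorProduct.map (wb.counit ∘ₗ mulLeft k x) (LinearMap.mul' k H ∘ₗ rTensor H S) ∘ₗ
              lTensor H (lTensor H f) ∘ₗ lTensor H wb.comul := by
          rw [← lTensor_comp, map_comp_lTensor, comp_assoc, ← comp_assoc _ _ (rTensor H S),
            rTensor_comp_lTensor]
        have h₃ := h₂ LinearMap.id
        rw [lTensor_id, lTensor_id, LinearMap.id_comp] at h₃
        rw [hf, hf, h₂, comp_apply, comp_apply, h₁]
        exact congr_arg _ (LinearMap.congr_fun h₃ _).symm
    _ = wb.projR (wb.projBarR x) := hS.antipode_left _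
    _ = wb.projR x := wb.projR_projBarR x

open WithConv in
/-- The antipode is antimultiplicative. -/
theorem antipode_mul (a b : H) : S (a * b) = S b * S a := by
  let := wb.toCoalgebra
  let ι₁ (f : H →ₗ[k] H) : WithConv (H ⊗[k] H →ₗ[k] H) :=
    toConv ((TensorProduct.rid k H).toLinearMap ∘ₗ TensorProduct.map f wb.counit)
  let ι₂ (f : H →ₗ[k] H) : WithConv (H ⊗[k] H →ₗ[k] H) :=
    toConv ((TensorProduct.lid k H).toLinearMap ∘ₗ TensorProduct.map wb.counit f)
  let μ (f : H →ₗ[k] H) : WithConv (H ⊗[k] H →ₗ[k] H) := toConv (f ∘ₗ LinearMap.mul' k H)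
  let conv (f g : H →ₗ[k] H) : H →ₗ[k] H := LinearMap.mul' k H ∘ₗ TensorProduct.map f g ∘ₗ wb.comul
  have ι₁_tmul (f x y) : ι₁ f (x ⊗ₜ y) = wb.counit y • f x := by
    simp [ι₁]
  have ι₂_tmul (f x y) : ι₂ f (x ⊗ₜ y) = wb.counit x • f y := by
    simp [ι₂]
  have μ_tmul (f x y) : μ f (x ⊗ₜ y) = f (x * y) := by
    simp [μ]
  have ext {f g : WithConv (H ⊗[k] H →ₗ[k] H)} (h : ∀ x y, f (x ⊗ₜ y) = g (x ⊗ₜ y)) : f = g :=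
    WithConv.ofConv_injective (TensorProduct.ext' h)
  have mul_ι₁ (f : WithConv (H ⊗[k] H →ₗ[k] H)) (g x y) : (f * ι₁ g) (x ⊗ₜ y) =
      LinearMap.mul' k H
        (TensorProduct.map (f.ofConv ∘ₗ (TensorProduct.mk k H H).flip y) g (wb.comul x)) := by
    have h (u v : H ⊗[k] H) : LinearMap.mul' k H (TensorProduct.map f.ofConv (ι₁ g).ofConv
        (TensorProduct.tensorTensorTensorComm k H H H H (u ⊗ₜ v))) = LinearMap.mul' k H
        (TensorProduct.map (f.ofConv ∘ₗ (TensorProduct.mk k H H).flip (wb.idε v)) g u) := by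
      induction u with
      | zero => simp
      | add u u' hu hu' => simp only [TensorProduct.add_tmul, map_add, hu, hu']
      | tmul z w =>
        induction v with
        | zero => simp
        | add v v' hv hv' =>
          rw [TensorProduct.tmul_add, map_add, map_add, map_add, hv, hv']
          simp [add_mul]
        | tmul z' w' => simp [ι₁]
    exact (h (wb.comul x) (wb.comul y)).trans <| by
      rw [show wb.idε (wb.comul y) = y from wb.lTensor_counit_comul y]
  have mul_ι₂ (f : WithConv (H ⊗[k] H →ₗ[k] H)) (g x y) : (f * ι₂ g) (x ⊗ₜ y) =
      LinearMap.mul' k H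
        (TensorProduct.map (f.ofConv ∘ₗ TensorProduct.mk k H H x) g (wb.comul y)) := by
    have h (u v : H ⊗[k] H) : LinearMap.mul' k H (TensorProduct.map f.ofConv (ι₂ g).ofConv
        (TensorProduct.tensorTensorTensorComm k H H H H (u ⊗ₜ v))) = LinearMap.mul' k H
        (TensorProduct.map (f.ofConv ∘ₗ TensorProduct.mk k H H (wb.idε u)) g v) := by
      induction v with
      | zero => simp
      | add v v' hv hv' => simp only [TensorProduct.tmul_add, map_add, hv, hv']
      | tmul z w =>
        induction u with
        | zero => simp
        | add u u' hu hu' =>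
          rw [TensorProduct.add_tmul, map_add, map_add, map_add, hu, hu']
          simp [TensorProduct.add_tmul]
        | tmul z' w' => simp [ι₂, ← TensorProduct.smul_tmul']
    exact (h (wb.comul x) (wb.comul y)).trans <| by
      rw [show wb.idε (wb.comul x) = x from wb.lTensor_counit_comul x]
  have ι₂_mul (f : WithConv (H ⊗[k] H →ₗ[k] H)) (g x y) : (ι₂ g * f) (x ⊗ₜ y) =
      LinearMap.mul' k H
        (TensorProduct.map g (f.ofConv ∘ₗ TensorProduct.mk k H H x) (wb.comul y)) := by
    have h (u v : H ⊗[k] H) : LinearMap.mul' k H (TensorProduct.map (ι₂ g).ofConv f.ofConv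
        (TensorProduct.tensorTensorTensorComm k H H H H (u ⊗ₜ v))) = LinearMap.mul' k H
        (TensorProduct.map g (f.ofConv ∘ₗ TensorProduct.mk k H H (wb.εid u)) v) := by
      induction v with
      | zero => simp
      | add v v' hv hv' => simp only [TensorProduct.tmul_add, map_add, hv, hv']
      | tmul z w =>
        induction u with
        | zero => simp
        | add u u' hu hu' =>
          rw [TensorProduct.add_tmul, map_add, map_add, map_add, hu, hu']
          simp [mul_add]
        | tmul z' w' => simp [ι₂, ← TensorProduct.smul_tmul']
    exact (h (wb.comul x) (wb.comul y)).trans <| by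
      rw [show wb.εid (wb.comul x) = x from wb.rTensor_counit_comul x]
  have ι₁_mul_ι₁ (f g) : ι₁ f * ι₁ g = ι₁ (conv f g) := ext fun x y => by
    rw [mul_ι₁, ι₁_tmul]
    simp only [conv, comp_apply]
    induction wb.comul x with
    | zero => simp
    | add u u' hu hu' => simp only [map_add, hu, hu', smul_add]
    | tmul z w => simp [ι₁]
  have ι₂_mul_ι₂ (f g) : ι₂ f * ι₂ g = ι₂ (conv f g) := ext fun x y => by
    rw [mul_ι₂, ι₂_tmul]
    simp only [conv, comp_apply]
    induction wb.comul y with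
    | zero => simp
    | add u u' hu hu' => simp only [map_add, hu, hu', smul_add]
    | tmul z w => simp [ι₂]
  have ι₁_mul_ι₂ (f g x y) : (ι₁ f * ι₂ g) (x ⊗ₜ y) = f x * g y := by
    rw [mul_ι₂, ← congr_arg g (wb.rTensor_counit_comul y)]
    induction wb.comul y with
    | zero => simp
    | add u u' hu hu' => simp only [map_add, hu, hu', mul_add]
    | tmul z w => simp [ι₁]
  have ι₂_mul_ι₁ (f g x y) : (ι₂ f * ι₁ g) (x ⊗ₜ y) = f y * g x := by
    rw [mul_ι₁, ← congr_arg g (wb.rTensor_counit_comul x)]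
    induction wb.comul x with
    | zero => simp
    | add u u' hu hu' => simp only [map_add, hu, hu', mul_add]
    | tmul z w => simp [ι₂]
  have μ_mul_μ (f g) : μ f * μ g = μ (conv f g) := ext fun x y => by
    have h (u v : H ⊗[k] H) : LinearMap.mul' k H (TensorProduct.map (μ f).ofConv (μ g).ofConv
        (TensorProduct.tensorTensorTensorComm k H H H H (u ⊗ₜ v))) =
        LinearMap.mul' k H (TensorProduct.map f g (u * v)) := by
      induction u with
      | zero => simp
      | add u u' hu hu' => simp only [TensorProduct.add_tmul, add_mul, map_add, hu, hu']
      | tmul z w =>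
        induction v with
        | zero => simp
        | add v v' hv hv' => simp only [TensorProduct.tmul_add, mul_add, map_add, hv, hv']
        | tmul z' w' => simp [μ]
    refine (h (wb.comul x) (wb.comul y)).trans ?_
    rw [μ_tmul, ← wb.comul_mul]
    rfl
  have left : conv S LinearMap.id = wb.projR := LinearMap.ext hS.antipode_left
  have right : conv LinearMap.id S = wb.projL := LinearMap.ext hS.antipode_right
  have midL : conv S wb.projL = S := LinearMap.ext hS.antipode_mul_projL
  have midR : conv wb.projR S = S := LinearMap.ext hS.projR_mul_antipode
  have comm : ι₁ wb.projR * ι₂ wb.projL = ι₂ wb.projL * ι₁ wb.projR := ext fun x y => by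
    rw [ι₁_mul_ι₂, ι₂_mul_ι₁, projR_mul_projL]
  have μ_id : μ LinearMap.id = ι₁ LinearMap.id * ι₂ LinearMap.id := ext fun x y => by
    rw [ι₁_mul_ι₂, μ_tmul]
    rfl
  have hL : ι₂ S * ι₁ S * μ LinearMap.id = μ wb.projR := by
    rw [μ_id, mul_assoc, ← mul_assoc (ι₁ S), ι₁_mul_ι₁, left]
    refine ext fun x y => ?_
    rw [ι₂_mul, μ_tmul, ← hS.antipode_mul_projR_mul]
    congr 3
    exact LinearMap.ext fun z => ι₁_mul_ι₂ _ _ _ _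
  have hR : μ LinearMap.id * (ι₂ S * ι₁ S) = μ wb.projL := by
    rw [μ_id, mul_assoc, ← mul_assoc (ι₂ _), ι₂_mul_ι₂, right, ← mul_assoc]
    refine ext fun x y => ?_
    rw [mul_ι₁, μ_tmul, ← hS.mul_projL_mul_antipode]
    congr 3
    exact LinearMap.ext fun z => ι₁_mul_ι₂ _ _ _ _
  have key : μ S = ι₂ S * ι₁ S := calc
    μ S = μ S * μ LinearMap.id * μ S := by rw [μ_mul_μ, left, μ_mul_μ, midR]
    _ = ι₂ S * ι₁ S * (μ LinearMap.id * μ S) := by rw [← mul_assoc, hL, μ_mul_μ, left]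
    _ = ι₂ S * ι₁ S * (μ LinearMap.id * (ι₂ S * ι₁ S)) := by rw [hR, μ_mul_μ, right]
    _ = ι₂ S * ((ι₁ S * ι₁ LinearMap.id) * (ι₂ LinearMap.id * ι₂ S)) * ι₁ S := by
      rw [μ_id]
      simp only [mul_assoc]
    _ = (ι₂ S * ι₂ wb.projL) * (ι₁ wb.projR * ι₁ S) := by
      rw [ι₁_mul_ι₁, ι₂_mul_ι₂, left, right, comm]
      simp only [mul_assoc]
    _ = ι₂ S * ι₁ S := by rw [ι₂_mul_ι₂, ι₁_mul_ι₁, midL, midR]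
  rw [← μ_tmul, key, ι₂_mul_ι₁]

end IsAntipode

end WeakBialgebra

/-- for a weak Hopf algebra `H` with bijective antipode `S` (inverse `S̄`) and a
right `H`-comodule algebra `A`, the maps `η(a ⊗ h) = a₍₀₎ ⊗ a₍₁₎S(h)`,
`η̄(a ⊗ h) = a₍₀₎ ⊗ S̄(h)a₍₁₎`, `p(a ⊗ h) = a1₍₀₎ ⊗ h1₍₁₎` and `p̄(a ⊗ h) = 1₍₀₎a ⊗ 1₍₁₎h`
satisfy `η∘p = η`, `η̄∘p̄ = η̄`, `η̄∘η = p`, `η∘η̄ = p̄`; consequently `η` restricts to a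
bijection `(A ⊗ H)ρ(1) → ρ(1)(A ⊗ H)` with inverse the restriction of `η̄`. -/
theorem statement10 {k : Type*} [Field k] {H : Type*} [Ring H] [Algebra k H]
    [FiniteDimensional k H] (wb : WeakBialgebra k H) (S : H →ₗ[k] H) (hS : wb.IsAntipode S)
    (Sbar : H →ₗ[k] H) (hSbar₁ : ∀ x : H, Sbar (S x) = x) (hSbar₂ : ∀ x : H, S (Sbar x) = x)
    {A : Type*} [Ring A] [Algebra k A] (ca : ComodAlg wb A)
    (η ηb : A ⊗[k] H →ₗ[k] A ⊗[k] H)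
    (hη : ∀ (a : A) (h : H), η (a ⊗ₜ[k] h) = ca.ρ a * ((1 : A) ⊗ₜ[k] S h))
    (hηb : ∀ (a : A) (h : H), ηb (a ⊗ₜ[k] h) = ((1 : A) ⊗ₜ[k] Sbar h) * ca.ρ a) :
    -- `η ∘ p = η` where `p` is right multiplication by `ρ(1)`
    η ∘ₗ LinearMap.mulRight k (ca.ρ 1) = η ∧
    -- `η̄ ∘ p̄ = η̄` where `p̄` is left multiplication by `ρ(1)`
    ηb ∘ₗ LinearMap.mulLeft k (ca.ρ 1) = ηb ∧
    -- `η̄ ∘ η = p`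
    ηb ∘ₗ η = LinearMap.mulRight k (ca.ρ 1) ∧
    -- `η ∘ η̄ = p̄`
    η ∘ₗ ηb = LinearMap.mulLeft k (ca.ρ 1) ∧
    -- `η` restricts to a bijection `(A ⊗ H)ρ(1) → ρ(1)(A ⊗ H)` with inverse `η̄`
    (∀ z ∈ Set.range (fun w : A ⊗[k] H => w * ca.ρ 1),
      η z ∈ Set.range (fun w : A ⊗[k] H => ca.ρ 1 * w) ∧ ηb (η z) = z) ∧
    (∀ z ∈ Set.range (fun w : A ⊗[k] H => ca.ρ 1 * w),
      ηb z ∈ Set.range (fun w : A ⊗[k] H => w * ca.ρ 1) ∧ η (ηb z) = z) := by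
  have Sbar_mul (x y : H) : Sbar (x * y) = Sbar y * Sbar x := by
    rw [← hSbar₂ x, ← hSbar₂ y, ← hS.antipode_mul, hSbar₁, hSbar₁, hSbar₁]
  have Sbar_comul (x : H) : LinearMap.mul' k H
      (TensorProduct.comm k H H (lTensor H Sbar (wb.comul x))) = wb.projBarR x := by
    apply (Function.LeftInverse.injective hSbar₁)
    rw [hS.antipode_projBarR, ← hS.antipode_left]
    induction wb.comul x with
    | zero => simp
    | add u v hu hv => simp only [map_add, hu, hv]
    | tmul y z => simp [hS.antipode_mul, hSbar₂]
  have one_mul_ρ (a : A) : ca.ρ 1 * ca.ρ a = ca.ρ a := by rw [← ca.mul, one_mul]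
  have ρ_mul_one (a : A) : ca.ρ a * ca.ρ 1 = ca.ρ a := by rw [← ca.mul, mul_one]
  have η_tmul_mul (a : A) (h : H) (w : A ⊗[k] H) :
      η ((a ⊗ₜ h) * w) = ca.ρ a * η w * (1 ⊗ₜ S h) := by
    induction w with
    | zero => simp
    | add u v hu hv => simp only [mul_add, add_mul, map_add, hu, hv]
    | tmul y z => simp [hη, ca.mul, hS.antipode_mul, mul_assoc]
  have ηb_mul_tmul (a : A) (h : H) (w : A ⊗[k] H) :
      ηb (w * (a ⊗ₜ h)) = (1 ⊗ₜ Sbar h) * ηb w * ca.ρ a := by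
    induction w with
    | zero => simp
    | add u v hu hv => simp only [mul_add, add_mul, map_add, hu, hv]
    | tmul y z =>
      simp only [Algebra.TensorProduct.tmul_mul_tmul, hηb, ca.mul, Sbar_mul, mul_assoc]
      simp only [← mul_assoc, Algebra.TensorProduct.tmul_mul_tmul, one_mul]
  have η_ρ (a : A) : η (ca.ρ a) = ca.ρ 1 * (a ⊗ₜ 1) := by
    rw [← ca.piL, ← LinearMap.ext (f := LinearMap.mul' k H ∘ₗ lTensor H S ∘ₗ wb.comul)
      hS.antipode_right, lTensor_comp, lTensor_comp, comp_apply, comp_apply, ← ca.coassoc]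
    induction ca.ρ a with
    | zero => simp
    | add u v hu hv => simp only [map_add, hu, hv]
    | tmul y z =>
      rw [hη, rTensor_tmul]
      induction ca.ρ y with
      | zero => simp
      | add u v hu hv => simp only [add_mul, TensorProduct.add_tmul, map_add, hu, hv]
      | tmul y z => simp
  have ηb_ρ (a : A) : ηb (ca.ρ a) = (a ⊗ₜ 1) * ca.ρ 1 := by
    rw [← ca.pibarR, ← LinearMap.ext (f := LinearMap.mul' k H ∘ₗ
        (TensorProduct.comm k H H).toLinearMap ∘ₗ lTensor H Sbar ∘ₗ wb.comul) Sbar_comul,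
      lTensor_comp, lTensor_comp, lTensor_comp, comp_apply, comp_apply, comp_apply, ← ca.coassoc]
    induction ca.ρ a with
    | zero => simp
    | add u v hu hv => simp only [map_add, hu, hv]
    | tmul y z =>
      rw [hηb, rTensor_tmul]
      induction ca.ρ y with
      | zero => simp
      | add u v hu hv => simp only [mul_add, TensorProduct.add_tmul, map_add, hu, hv]
      | tmul y z => simp
  have one_mul_η (z : A ⊗[k] H) : ca.ρ 1 * η z = η z := by
    induction z with
    | zero => simp
    | add u v hu hv => simp only [mul_add, map_add, hu, hv]
    | tmul a h => rw [hη, ← mul_assoc, one_mul_ρ]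
  have ηb_mul_one (z : A ⊗[k] H) : ηb z * ca.ρ 1 = ηb z := by
    induction z with
    | zero => simp
    | add u v hu hv => simp only [add_mul, map_add, hu, hv]
    | tmul a h => rw [hηb, mul_assoc, ρ_mul_one]
  have ηb_η : ηb ∘ₗ η = LinearMap.mulRight k (ca.ρ 1) := TensorProduct.ext' fun a h => by
    have hw (w : A ⊗[k] H) : ηb (w * (1 ⊗ₜ S h)) = (1 ⊗ₜ h) * ηb w := by
      rw [ηb_mul_tmul, hSbar₁, mul_assoc, ηb_mul_one]
    rw [comp_apply, hη, hw, ηb_ρ, mulRight_apply, ← mul_assoc]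
    simp
  have η_ηb : η ∘ₗ ηb = LinearMap.mulLeft k (ca.ρ 1) := TensorProduct.ext' fun a h => by
    rw [comp_apply, hηb, η_tmul_mul, one_mul_η, η_ρ, hSbar₂, mulLeft_apply, mul_assoc]
    simp
  refine ⟨TensorProduct.ext' fun a h => ?_, TensorProduct.ext' fun a h => ?_, ηb_η, η_ηb, ?_, ?_⟩
  · rw [comp_apply, mulRight_apply, η_tmul_mul, η_ρ, ← Algebra.TensorProduct.one_def, mul_one,
      ρ_mul_one, hη]
  · rw [comp_apply, mulLeft_apply, ηb_mul_tmul, ηb_ρ, ← Algebra.TensorProduct.one_def, one_mul,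
      mul_assoc, one_mul_ρ, hηb]
  · rintro _ ⟨w, rfl⟩
    refine ⟨⟨_, one_mul_η _⟩, ?_⟩
    exact (LinearMap.congr_fun ηb_η _).trans (by simp [mul_assoc, one_mul_ρ])
  · rintro _ ⟨w, rfl⟩
    refine ⟨⟨_, ηb_mul_one _⟩, ?_⟩
    exact (LinearMap.congr_fun η_ηb _).trans (by simp [← mul_assoc, one_mul_ρ])
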